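/- Suppose a bigraph B=(G,H) with biedge set ℰ without self-loops untangles via a biedge ē∈ℰ into bigraphs B₁ and B₂ (with ℰ₁ and ℰ₂ both nonempty), where ē is neither a bridge in G nor a bridge in H. If B₁ has Laman number N₁ with respect to some biedge e₁∈ℰ₁ and B₂ has Laman number N₂ with respect to some biedge e₂∈ℰ₂, then B has Laman number N₁·N₂ with respect to ē. -/

import Mathlib

set_option maxHeartbeats 1000000

noncomputable section
open Classical

namespace LamanPaper

variable {V E : Type}

/-- The adjacency relation induced by an incidence map `ends`. -/
def adjRel (ends : E → Sym2 V) : V → V → Prop := fun u v => ∃ e : E, ends e = s(u, v)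

/-- The setoid of connected components of the graph with incidence map `ends`. -/
def ccSetoid (ends : E → Sym2 V) : Setoid V :=
  ⟨Relation.EqvGen (adjRel ends), Relation.EqvGen.is_equivalence _⟩

/-- The number of connected components. -/
def numCC (ends : E → Sym2 V) : ℕ := Nat.card (Quotient (ccSetoid ends))

/-- The dimension of a graph: number of vertices minus number of connected components. -/
def gDim (ends : E → Sym2 V) : ℕ := Nat.card V - numCC ends

/-- Restriction of a graph to a set of edges. -/
def restrictEnds (ends : E → Sym2 V) (S : Set E) : {e : E // e ∈ S} → Sym2 V :=
  fun e => ends e.1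

/-- Deletion of a set of edges from a graph. -/
def deleteEnds (ends : E → Sym2 V) (S : Set E) : {e : E // e ∉ S} → Sym2 V :=
  fun e => ends e.1

/-- The setoid on vertices generated by contracting the edges in `S`. -/
def contrSetoid (ends : E → Sym2 V) (S : Set E) : Setoid V :=
  ⟨Relation.EqvGen fun u v => ∃ e ∈ S, ends e = s(u, v), Relation.EqvGen.is_equivalence _⟩

/-- Contraction of the edges in `S`: the remaining edges join the equivalence classes of
their endpoints. -/
def contractEnds (ends : E → Sym2 V) (S : Set E) :
    {e : E // e ∉ S} → Sym2 (Quotient (contrSetoid ends S)) :=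
  fun e => (ends e.1).map (Quotient.mk (contrSetoid ends S))

/-- An edge is a bridge if deleting it increases the number of connected components. -/
def IsBridge (ends : E → Sym2 V) (e : E) : Prop :=
  numCC ends < numCC (deleteEnds ends ({e} : Set E))

/-- The smaller endpoint of an (unordered) edge, with respect to a linear order. -/
def sMin [LinearOrder V] (s : Sym2 V) : V :=
  Sym2.lift ⟨fun a b => min a b, fun a b => min_comm a b⟩ s

/-- The larger endpoint of an (unordered) edge, with respect to a linear order. -/
def sMax [LinearOrder V] (s : Sym2 V) : V :=
  Sym2.lift ⟨fun a b => max a b, fun a b => max_comm a b⟩ s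

theorem sMin_mem [LinearOrder V] (s : Sym2 V) : sMin s ∈ s := by
  induction s using Sym2.ind with
  | _ x y => rcases min_choice x y with h | h <;> simp [sMin, Sym2.lift_mk, h, Sym2.mem_iff]

theorem sMax_mem [LinearOrder V] (s : Sym2 V) : sMax s ∈ s := by
  induction s using Sym2.ind with
  | _ x y => rcases max_choice x y with h | h <;> simp [sMax, Sym2.lift_mk, h, Sym2.mem_iff]

/-- A bigraph: a pair of finite multigraphs `G = (V, ℰ)` and `H = (W, ℰ)` sharing the same
set of (bi)edges, together with fixed total orders on the two vertex sets. -/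
structure Bigraph where
  ℰ : Type
  V : Type
  W : Type
  finE : Finite ℰ
  finV : Finite V
  finW : Finite W
  τG : ℰ → Sym2 V
  τH : ℰ → Sym2 W
  ordV : LinearOrder V
  ordW : LinearOrder W

namespace Bigraph

variable (B : Bigraph)

instance : Finite B.ℰ := B.finE
instance : Finite B.V := B.finV
instance : Finite B.W := B.finW

/-- The dimension of the first graph of a bigraph. -/
def dimG : ℕ := gDim B.τG

/-- The dimension of the second graph of a bigraph. -/
def dimH : ℕ := gDim B.τH

/-- A bigraph is pseudo-Laman if `dim G + dim H = |ℰ| + 1`. -/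
def PseudoLaman : Prop := B.dimG + B.dimH = Nat.card B.ℰ + 1

/-- A bigraph has a (self-)loop if some biedge is a self-loop in `G` or in `H`. -/
def HasLoop : Prop := (∃ e, (B.τG e).IsDiag) ∨ (∃ e, (B.τH e).IsDiag)

/-- The set `P` of ordered pairs of distinct vertices of `G` joined by some edge. -/
def Pset : Set (B.V × B.V) := {p | p.1 ≠ p.2 ∧ ∃ e, B.τG e = s(p.1, p.2)}

/-- The set `Q` of ordered pairs of distinct vertices of `H` joined by some edge. -/
def Qset : Set (B.W × B.W) := {q | q.1 ≠ q.2 ∧ ∃ e, B.τH e = s(q.1, q.2)}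

/-- The smaller endpoint (w.r.t. the fixed total order) of a biedge in `G`. -/
def eFstG (e : B.ℰ) : B.V := letI := B.ordV; sMin (B.τG e)

/-- The larger endpoint of a biedge in `G`. -/
def eSndG (e : B.ℰ) : B.V := letI := B.ordV; sMax (B.τG e)

/-- The smaller endpoint of a biedge in `H`. -/
def eFstH (e : B.ℰ) : B.W := letI := B.ordW; sMin (B.τH e)

/-- The larger endpoint of a biedge in `H`. -/
def eSndH (e : B.ℰ) : B.W := letI := B.ordW; sMax (B.τH e)

theorem eFstG_mem (e : B.ℰ) : B.eFstG e ∈ B.τG e := by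
  letI := B.ordV; exact sMin_mem _

theorem eSndG_mem (e : B.ℰ) : B.eSndG e ∈ B.τG e := by
  letI := B.ordV; exact sMax_mem _

theorem eFstH_mem (e : B.ℰ) : B.eFstH e ∈ B.τH e := by
  letI := B.ordW; exact sMin_mem _

theorem eSndH_mem (e : B.ℰ) : B.eSndH e ∈ B.τH e := by
  letI := B.ordW; exact sMax_mem _

/-- The affine solution set `Z^B(λ)` of a bigraph with distinguished biedge `ebar` and
parameters `lam`. -/
def ZSet (ebar : B.ℰ) (lam : {e : B.ℰ // e ≠ ebar} → ℂ) :
    Set ((↥B.Pset → ℂ) × (↥B.Qset → ℂ)) :=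
  {xy |
    (∀ p : ↥B.Pset, (p : B.V × B.V) = (B.eFstG ebar, B.eSndG ebar) → xy.1 p = 1) ∧
    (∀ q : ↥B.Qset, (q : B.W × B.W) = (B.eFstH ebar, B.eSndH ebar) → xy.2 q = 1) ∧
    (∀ e : {e : B.ℰ // e ≠ ebar}, ∀ p : ↥B.Pset, ∀ q : ↥B.Qset,
      (p : B.V × B.V) = (B.eFstG e.1, B.eSndG e.1) →
      (q : B.W × B.W) = (B.eFstH e.1, B.eSndH e.1) →
      xy.1 p * xy.2 q = lam e) ∧
    (∀ (n : ℕ) (u : ℕ → B.V) (w : Fin n → ↥B.Pset),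
      (∀ i : Fin n, (w i : B.V × B.V) = (u i.1, u (i.1 + 1))) → u n = u 0 →
      ∑ i, xy.1 (w i) = 0) ∧
    (∀ (n : ℕ) (u : ℕ → B.W) (w : Fin n → ↥B.Qset),
      (∀ i : Fin n, (w i : B.W × B.W) = (u i.1, u (i.1 + 1))) → u n = u 0 →
      ∑ i, xy.2 (w i) = 0)}

/-- `B` has Laman number `N` with respect to the biedge `ebar`:  there is a nonzero
polynomial `p` in the parameters such that whenever `p` does not vanish, the solution set
`Z^B(λ)` has exactly `N` elements.  By convention a bigraph containing a self-loop has
Laman number `0`. -/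
def HasLamanNumber (ebar : B.ℰ) (N : ℕ) : Prop :=
  (B.HasLoop ∧ N = 0) ∨
  (¬ B.HasLoop ∧ ∃ P : MvPolynomial {e : B.ℰ // e ≠ ebar} ℂ, P ≠ 0 ∧
    ∀ lam : {e : B.ℰ // e ≠ ebar} → ℂ, MvPolynomial.eval lam P ≠ 0 →
      (B.ZSet ebar lam).Finite ∧ Nat.card ↥(B.ZSet ebar lam) = N)

/-- The bigraph obtained by restricting the biedges to a subset `S` (both in `G` and `H`). -/
def restrict (S : Set B.ℰ) : Bigraph where
  ℰ := {e : B.ℰ // e ∈ S}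
  V := B.V
  W := B.W
  finE := Subtype.finite
  finV := B.finV
  finW := B.finW
  τG := fun e => B.τG e.1
  τH := fun e => B.τH e.1
  ordV := B.ordV
  ordW := B.ordW

/-- The bigraph `^M B = (G / M, H ∖ M)`: contract the biedges of `M` in `G` and delete them
in `H`. -/
def ctrG (M : Set B.ℰ) (ord : LinearOrder (Quotient (contrSetoid B.τG M))) : Bigraph where
  ℰ := {e : B.ℰ // e ∉ M}
  V := Quotient (contrSetoid B.τG M)
  W := B.W
  finE := Subtype.finite
  finV := Quotient.finite _
  finW := B.finW
  τG := contractEnds B.τG M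
  τH := fun e => B.τH e.1
  ordV := ord
  ordW := B.ordW

/-- The bigraph `B ^ M = (G ∖ M, H / M)`: delete the biedges of `M` in `G` and contract them
in `H`. -/
def ctrH (M : Set B.ℰ) (ord : LinearOrder (Quotient (contrSetoid B.τH M))) : Bigraph where
  ℰ := {e : B.ℰ // e ∉ M}
  V := B.V
  W := Quotient (contrSetoid B.τH M)
  finE := Subtype.finite
  finV := B.finV
  finW := Quotient.finite _
  τG := fun e => B.τG e.1
  τH := contractEnds B.τH M
  ordV := B.ordV
  ordW := ord

/-! ### Bidistances -/

/-- Symmetry of a function on `P`: `d_V(u,v) = d_V(v,u)`. -/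
def BidistSymmG (dV : ↥B.Pset → ℚ) : Prop :=
  ∀ p p' : ↥B.Pset, (p' : B.V × B.V) = ((p : B.V × B.V).2, (p : B.V × B.V).1) → dV p' = dV p

/-- Symmetry of a function on `Q`: `d_W(t,w) = d_W(w,t)`. -/
def BidistSymmH (dW : ↥B.Qset → ℚ) : Prop :=
  ∀ q q' : ↥B.Qset, (q' : B.W × B.W) = ((q : B.W × B.W).2, (q : B.W × B.W).1) → dW q' = dW q

/-- The sum condition: `d_V(u,v) + d_W(t,w) = wt(e)` for every biedge `e ≠ ebar`. -/
def BidistSum (ebar : B.ℰ) (wt : {e : B.ℰ // e ≠ ebar} → ℚ)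
    (dV : ↥B.Pset → ℚ) (dW : ↥B.Qset → ℚ) : Prop :=
  ∀ e : {e : B.ℰ // e ≠ ebar}, ∀ p : ↥B.Pset, ∀ q : ↥B.Qset,
    s((p : B.V × B.V).1, (p : B.V × B.V).2) = B.τG e.1 →
    s((q : B.W × B.W).1, (q : B.W × B.W).2) = B.τH e.1 →
    dV p + dW q = wt e

/-- The base condition: `d_V(ū,v̄) = d_W(t̄,w̄) = 0` on the distinguished biedge. -/
def BidistBase (ebar : B.ℰ) (dV : ↥B.Pset → ℚ) (dW : ↥B.Qset → ℚ) : Prop :=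
  (∀ p : ↥B.Pset, s((p : B.V × B.V).1, (p : B.V × B.V).2) = B.τG ebar → dV p = 0) ∧
  (∀ q : ↥B.Qset, s((q : B.W × B.W).1, (q : B.W × B.W).2) = B.τH ebar → dW q = 0)

/-- On every closed walk in `G`, the minimum of `d_V` over the consecutive vertex pairs is
attained at least twice. -/
def BidistMinG (dV : ↥B.Pset → ℚ) : Prop :=
  ∀ (n : ℕ) (u : ℕ → B.V) (w : Fin n → ↥B.Pset),
    (∀ i : Fin n, (w i : B.V × B.V) = (u i.1, u (i.1 + 1))) → u n = u 0 →
    ∀ i : Fin n, (∀ k, dV (w i) ≤ dV (w k)) → ∃ j, j ≠ i ∧ dV (w j) = dV (w i)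

/-- On every closed walk in `H`, the minimum of `d_W` over the consecutive vertex pairs is
attained at least twice. -/
def BidistMinH (dW : ↥B.Qset → ℚ) : Prop :=
  ∀ (n : ℕ) (u : ℕ → B.W) (w : Fin n → ↥B.Qset),
    (∀ i : Fin n, (w i : B.W × B.W) = (u i.1, u (i.1 + 1))) → u n = u 0 →
    ∀ i : Fin n, (∀ k, dW (w i) ≤ dW (w k)) → ∃ j, j ≠ i ∧ dW (w j) = dW (w i)

/-- A bidistance on `B` compatible with the weight vector `wt`. -/
def IsBidistance (ebar : B.ℰ) (wt : {e : B.ℰ // e ≠ ebar} → ℚ)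
    (dV : ↥B.Pset → ℚ) (dW : ↥B.Qset → ℚ) : Prop :=
  B.BidistSymmG dV ∧ B.BidistSymmH dW ∧ B.BidistSum ebar wt dV dW ∧
  B.BidistBase ebar dV dW ∧ B.BidistMinG dV ∧ B.BidistMinH dW

/-! ### The quotient bigraph `B_d` -/

/-- The value of `d_V` on (the endpoint pair of) a biedge. -/
def gvalG (dV : ↥B.Pset → ℚ) (e : B.ℰ) : ℚ :=
  if h : ∃ p : ↥B.Pset, s((p : B.V × B.V).1, (p : B.V × B.V).2) = B.τG e then dV h.choose
  else 0

/-- The value of `d_W` on (the endpoint pair of) a biedge. -/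
def gvalH (dW : ↥B.Qset → ℚ) (e : B.ℰ) : ℚ :=
  if h : ∃ q : ↥B.Qset, s((q : B.W × B.W).1, (q : B.W × B.W).2) = B.τH e then dW h.choose
  else 0

/-- Incidences of the graph `G`: pairs of a biedge and one of its endpoints. -/
def IncG := {q : B.ℰ × B.V // q.2 ∈ B.τG q.1}

/-- Incidences of the graph `H`. -/
def IncH := {q : B.ℰ × B.W // q.2 ∈ B.τH q.1}

instance : Finite B.IncG := by unfold IncG; infer_instance
instance : Finite B.IncH := by unfold IncH; infer_instance

/-- Two incidences `(e,v)`, `(e',v')` of `G` are identified in `B_d` if the `d_V`-levels of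
`e` and `e'` agree (say equal to `α`) and `v`, `v'` are connected by edges of level `> α`. -/
def relIncG (dV : ↥B.Pset → ℚ) : B.IncG → B.IncG → Prop := fun a b =>
  B.gvalG dV a.1.1 = B.gvalG dV b.1.1 ∧
  Relation.EqvGen (fun u v => ∃ e, B.gvalG dV a.1.1 < B.gvalG dV e ∧ B.τG e = s(u, v))
    a.1.2 b.1.2

def relIncH (dW : ↥B.Qset → ℚ) : B.IncH → B.IncH → Prop := fun a b =>
  B.gvalH dW a.1.1 = B.gvalH dW b.1.1 ∧
  Relation.EqvGen (fun u v => ∃ e, B.gvalH dW a.1.1 < B.gvalH dW e ∧ B.τH e = s(u, v))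
    a.1.2 b.1.2

def incSetoidG (dV : ↥B.Pset → ℚ) : Setoid B.IncG :=
  ⟨Relation.EqvGen (B.relIncG dV), Relation.EqvGen.is_equivalence _⟩

def incSetoidH (dW : ↥B.Qset → ℚ) : Setoid B.IncH :=
  ⟨Relation.EqvGen (B.relIncH dW), Relation.EqvGen.is_equivalence _⟩

/-- The vertices of the first graph `G_{d_V}` of the quotient bigraph `B_d`:
classes of incidences.  This realizes the disjoint union of the contractions
`G_{≥α} / G_{>α}` (with isolated vertices discarded). -/
def QVertG (dV : ↥B.Pset → ℚ) := Quotient (B.incSetoidG dV)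

def QVertH (dW : ↥B.Qset → ℚ) := Quotient (B.incSetoidH dW)

/-- The incidence map of `G_{d_V}`. -/
def quotEndsG (dV : ↥B.Pset → ℚ) : B.ℰ → Sym2 (B.QVertG dV) := fun e =>
  s(Quotient.mk (B.incSetoidG dV) ⟨(e, B.eFstG e), B.eFstG_mem e⟩,
    Quotient.mk (B.incSetoidG dV) ⟨(e, B.eSndG e), B.eSndG_mem e⟩)

/-- The incidence map of `H_{d_W}`. -/
def quotEndsH (dW : ↥B.Qset → ℚ) : B.ℰ → Sym2 (B.QVertH dW) := fun e =>
  s(Quotient.mk (B.incSetoidH dW) ⟨(e, B.eFstH e), B.eFstH_mem e⟩,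
    Quotient.mk (B.incSetoidH dW) ⟨(e, B.eSndH e), B.eSndH_mem e⟩)

/-- The quotient bigraph `B_d = (G_{d_V}, H_{d_W})` of a bigraph by a bidistance `(d_V, d_W)`,
with arbitrarily fixed total orders on the new vertex sets.  It has the same biedges as `B`. -/
def quotBigraph (dV : ↥B.Pset → ℚ) (dW : ↥B.Qset → ℚ)
    (oV : LinearOrder (B.QVertG dV)) (oW : LinearOrder (B.QVertH dW)) : Bigraph where
  ℰ := B.ℰ
  V := B.QVertG dV
  W := B.QVertH dW
  finE := B.finE
  finV := Quotient.finite _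
  finW := Quotient.finite _
  τG := B.quotEndsG dV
  τH := B.quotEndsH dW
  ordV := oV
  ordW := oW

/-! ### Untangling -/

/-- `B` untangles via the biedge `ebar` with respect to the decomposition
`ℰ = E1 ⊔ E2 ⊔ {ebar}`, `V = V1 ⊔ V2`, `W = W1 ⊔ W2`:  the graph `G` is the disjoint union
of the subgraph on `V1` with edges `E1 ∪ {ebar}` and the subgraph on `V2` with edges `E2`,
while `H` is the disjoint union of the subgraph on `W1` with edges `E1` and the subgraph on
`W2` with edges `E2 ∪ {ebar}`.  The two bigraphs into which `B` untangles are then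
`B₁ = B.restrict E1` and `B₂ = B.restrict E2`. -/
def Untangles (ebar : B.ℰ) (E1 E2 : Set B.ℰ) (V1 V2 : Set B.V) (W1 W2 : Set B.W) : Prop :=
  ebar ∉ E1 ∧ ebar ∉ E2 ∧ E1 ∩ E2 = ∅ ∧ (∀ e : B.ℰ, e = ebar ∨ e ∈ E1 ∨ e ∈ E2) ∧
  V1 ∩ V2 = ∅ ∧ V1 ∪ V2 = Set.univ ∧
  (∀ e ∈ E1, ∀ v, v ∈ B.τG e → v ∈ V1) ∧ (∀ v, v ∈ B.τG ebar → v ∈ V1) ∧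
  (∀ e ∈ E2, ∀ v, v ∈ B.τG e → v ∈ V2) ∧
  W1 ∩ W2 = ∅ ∧ W1 ∪ W2 = Set.univ ∧
  (∀ e ∈ E1, ∀ x, x ∈ B.τH e → x ∈ W1) ∧
  (∀ e ∈ E2, ∀ x, x ∈ B.τH e → x ∈ W2) ∧ (∀ x, x ∈ B.τH ebar → x ∈ W2)

/-! ### The rational map `f_B` -/

/-- The vector of coordinates of the rational map `f_B`, evaluated on representatives
`x : V → ℂ` and `y : W → ℂ`:  the `e`-th coordinate is `(x_u - x_v)(y_t - y_w)` where
`{u,v} = τ_G(e)` with `u ≺ v` and `{t,w} = τ_H(e)` with `t ≺ w`.  (For a self-loop the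
corresponding factor is `0`.) -/
def fVec (x : B.V → ℂ) (y : B.W → ℂ) : B.ℰ → ℂ :=
  fun e => (x (B.eFstG e) - x (B.eSndG e)) * (y (B.eFstH e) - y (B.eSndH e))

/-- The subspace `L_G` of vectors that are constant on each connected component of `G`. -/
def LG : Submodule ℂ (B.V → ℂ) where
  carrier := {x | ∀ u v : B.V, Relation.EqvGen (adjRel B.τG) u v → x u = x v}
  add_mem' := by
    intro a b ha hb u v h
    simp only [Pi.add_apply, ha u v h, hb u v h]
  zero_mem' := by intro u v _; rfl
  smul_mem' := by
    intro c a ha u v h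
    simp only [Pi.smul_apply, ha u v h]

/-- The subspace `L_H` of vectors that are constant on each connected component of `H`. -/
def LH : Submodule ℂ (B.W → ℂ) where
  carrier := {y | ∀ u v : B.W, Relation.EqvGen (adjRel B.τH) u v → y u = y v}
  add_mem' := by
    intro a b ha hb u v h
    simp only [Pi.add_apply, ha u v h, hb u v h]
  zero_mem' := by intro u v _; rfl
  smul_mem' := by
    intro c a ha u v h
    simp only [Pi.smul_apply, ha u v h]

/-- Dominance of the rational map `f_B`:  the image of `f_B` is not contained in any
proper algebraic subset of `ℙ(ℂ^ℰ)`, equivalently in no zero set of a nonzero homogeneous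
polynomial. -/
def FDominant : Prop :=
  ¬ ∃ (n : ℕ) (P : MvPolynomial B.ℰ ℂ), P ≠ 0 ∧ P.IsHomogeneous n ∧
      ∀ (x : B.V → ℂ) (y : B.W → ℂ), MvPolynomial.eval (B.fVec x y) P = 0

end Bigraph


/-- translation automorphism -/
theorem height_vanishing_eq {ι : Type} [Finite ι] (z w : ι → ℂ) :
    (MvPolynomial.vanishingIdeal ℂ {z} : Ideal (MvPolynomial ι ℂ)).height =
      (MvPolynomial.vanishingIdeal ℂ {w} : Ideal (MvPolynomial ι ℂ)).height := by
  let f : (ι → ℂ) → (MvPolynomial ι ℂ →ₐ[ℂ] MvPolynomial ι ℂ) := fun c =>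
    MvPolynomial.aeval fun i => MvPolynomial.X i + MvPolynomial.C (c i)
  have hf : ∀ c, (f c).comp (f (-c)) = AlgHom.id ℂ _ := by
    intro c
    ext i
    simp [f]
  let e : MvPolynomial ι ℂ ≃ₐ[ℂ] MvPolynomial ι ℂ :=
    AlgEquiv.ofAlgHom (f (w - z)) (f (-(w - z))) (hf _) (by simpa using hf (-(w - z)))
  have hev : ∀ p, MvPolynomial.eval z (e p) = MvPolynomial.eval w p := by
    intro p
    have : (MvPolynomial.aeval z).comp (f (w - z)) = (MvPolynomial.aeval w : MvPolynomial ι ℂ →ₐ[ℂ] ℂ) := by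
      ext i
      simp [f]
    have h2 := congrArg (fun g => g p) this
    have h3 : MvPolynomial.eval z (f (w - z) p) = MvPolynomial.eval w p := by
      simpa [MvPolynomial.aeval_eq_eval] using h2
    exact h3
  have : (MvPolynomial.vanishingIdeal ℂ {w} : Ideal (MvPolynomial ι ℂ)) =
      (MvPolynomial.vanishingIdeal ℂ {z} : Ideal (MvPolynomial ι ℂ)).comap e.toRingEquiv := by
    ext p
    rw [Ideal.mem_comap, MvPolynomial.mem_vanishingIdeal_singleton_iff,
      MvPolynomial.mem_vanishingIdeal_singleton_iff]
    simp only [MvPolynomial.aeval_eq_eval]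
    exact (by rw [← hev p]; rfl)
  rw [this, RingEquiv.height_comap]

theorem card_le_height {ι : Type} [Finite ι] (z : ι → ℂ) :
    (Nat.card ι : ℕ∞) ≤ (MvPolynomial.vanishingIdeal ℂ {z} : Ideal (MvPolynomial ι ℂ)).height := by
  have h := MvPolynomial.ringKrullDim_of_isNoetherianRing (R := ℂ) (ι := ι)
  rw [← Ideal.sup_height_eq_ringKrullDim, ringKrullDim_eq_zero_of_field, zero_add] at h
  have h' : (⨆ (I : Ideal (MvPolynomial ι ℂ)) (_ : I ≠ ⊤), I.height) = (Nat.card ι : ℕ∞) := by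
    exact_mod_cast h
  rw [← h']
  refine iSup₂_le fun I hI => ?_
  obtain ⟨M, hM, hIM⟩ := Ideal.exists_le_maximal I hI
  obtain ⟨x, rfl⟩ := MvPolynomial.isMaximal_iff_eq_vanishingIdeal_singleton.1 hM
  rw [height_vanishing_eq z x]
  exact Ideal.height_mono hIM

theorem card_le_of_finite_fiber {ι κ : Type} [Finite ι] [Finite κ] (F : κ → MvPolynomial ι ℂ)
    (hfin : {z : ι → ℂ | ∀ k, MvPolynomial.eval z (F k) = 0}.Finite) (z : ι → ℂ)
    (hz : ∀ k, MvPolynomial.eval z (F k) = 0) : Nat.card ι ≤ Nat.card κ := by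
  set I := Ideal.span (Set.range F) with hI
  have hZ : MvPolynomial.zeroLocus ℂ I = {z : ι → ℂ | ∀ k, MvPolynomial.eval z (F k) = 0} := by
    rw [hI, MvPolynomial.zeroLocus_span]
    ext w
    simp [MvPolynomial.aeval_eq_eval]
  have hmin : (MvPolynomial.vanishingIdeal ℂ {z} : Ideal (MvPolynomial ι ℂ)) ∈ I.minimalPrimes := by
    have hmax : ∀ x : ι → ℂ, (MvPolynomial.vanishingIdeal ℂ {x} : Ideal (MvPolynomial ι ℂ)).IsMaximal :=
      fun x => MvPolynomial.isMaximal_iff_eq_vanishingIdeal_singleton.2 ⟨x, rfl⟩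
    refine ⟨⟨(hmax z).isPrime, ?_⟩, ?_⟩
    · rw [hI, Ideal.span_le]
      rintro _ ⟨k, rfl⟩
      simp only [SetLike.mem_coe]
      rw [MvPolynomial.mem_vanishingIdeal_singleton_iff]
      simpa [MvPolynomial.aeval_eq_eval] using hz k
    · rintro p ⟨hp, hIp⟩ hpz
      have hpf : (MvPolynomial.zeroLocus ℂ p).Finite := by
        refine Set.Finite.subset hfin ?_
        rw [← hZ]
        exact MvPolynomial.zeroLocus_anti_mono hIp
      have hle : hpf.toFinset.inf
          (fun x => (MvPolynomial.vanishingIdeal ℂ {x} : Ideal (MvPolynomial ι ℂ))) ≤ p := by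
        intro q hq
        rw [Submodule.mem_finsetInf] at hq
        have hvp := MvPolynomial.IsPrime.vanishingIdeal_zeroLocus (K := ℂ) p
        suffices q ∈ MvPolynomial.vanishingIdeal ℂ (MvPolynomial.zeroLocus ℂ p) by rwa [hvp] at this
        rw [MvPolynomial.mem_vanishingIdeal_iff]
        intro x hx
        have := hq x (by simpa using hx)
        rwa [MvPolynomial.mem_vanishingIdeal_singleton_iff] at this
      obtain ⟨x, -, hx⟩ := (Ideal.IsPrime.inf_le' hp).1 hle
      have h1 := (hmax x).eq_of_le (hmax z).ne_top (hx.trans hpz)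
      rw [← h1]; exact hx
  have h1 := Ideal.height_le_card_of_mem_minimalPrimes_span (Set.finite_range F) hmin
  have h2 := (card_le_height z).trans h1
  have h3 : Nat.card ι ≤ (Set.range F).ncard := by exact_mod_cast h2
  refine h3.trans ?_
  rw [← Set.image_univ, ← Set.ncard_univ κ]
  exact Set.ncard_image_le Set.finite_univ

theorem exists_relation {ι κ : Type} [Finite ι] [Finite κ] (F : κ → MvPolynomial ι ℂ)
    (h : Nat.card ι < Nat.card κ) :
    ∃ Q : MvPolynomial κ ℂ, Q ≠ 0 ∧
      ∀ z : ι → ℂ, MvPolynomial.eval (fun k => MvPolynomial.eval z (F k)) Q = 0 := by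
  have := Fintype.ofFinite κ
  have hni : ¬ AlgebraicIndependent ℂ F := by
    intro hF
    have h1 := hF.lift_cardinalMk_le_trdeg
    rw [MvPolynomial.trdeg_of_isDomain] at h1
    simp only [Cardinal.lift_id] at h1
    have h2 := Cardinal.toNat_le_toNat h1 (Cardinal.lt_aleph0_of_finite ι)
    have : Nat.card κ ≤ Nat.card ι := h2
    omega
  rw [algebraicIndependent_iff] at hni
  push Not at hni
  obtain ⟨Q, hQ, hQ0⟩ := hni
  refine ⟨Q, hQ0, fun z => ?_⟩
  have := congrArg (MvPolynomial.eval z) hQ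
  rw [map_zero] at this
  rw [← this, MvPolynomial.aeval_def, MvPolynomial.eval₂_eq', MvPolynomial.eval_eq']
  simp [map_sum]

theorem exists_homog {E : Type} [Finite E] (e₁ : E) (P : MvPolynomial {e : E // e ≠ e₁} ℂ)
    (hP : P ≠ 0) : ∃ Q : MvPolynomial E ℂ, Q ≠ 0 ∧ ∀ lam : E → ℂ, MvPolynomial.eval lam Q ≠ 0 →
      lam e₁ ≠ 0 → MvPolynomial.eval (fun e : {e : E // e ≠ e₁} => lam e.1 / lam e₁) P ≠ 0 := by
  have key : ∀ P : MvPolynomial {e : E // e ≠ e₁} ℂ, ∃ (Q : MvPolynomial E ℂ) (D : ℕ),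
      ∀ lam : E → ℂ, lam e₁ ≠ 0 → MvPolynomial.eval lam Q =
        lam e₁ ^ D * MvPolynomial.eval (fun e : {e : E // e ≠ e₁} => lam e.1 / lam e₁) P := by
    intro P
    induction P using MvPolynomial.induction_on with
    | C a => exact ⟨MvPolynomial.C a, 0, fun lam _ => by simp⟩
    | add p q hp hq =>
      obtain ⟨Q₁, D₁, h₁⟩ := hp
      obtain ⟨Q₂, D₂, h₂⟩ := hq
      refine ⟨MvPolynomial.X e₁ ^ D₂ * Q₁ + MvPolynomial.X e₁ ^ D₁ * Q₂, D₁ + D₂, fun lam hl => ?_⟩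
      simp [h₁ lam hl, h₂ lam hl]
      ring
    | mul_X p i hp =>
      obtain ⟨Q₁, D₁, h₁⟩ := hp
      refine ⟨Q₁ * MvPolynomial.X i.1, D₁ + 1, fun lam hl => ?_⟩
      simp [h₁ lam hl]
      field_simp
      ring
  obtain ⟨Q, D, hQ⟩ := key P
  refine ⟨Q, ?_, ?_⟩
  · rintro rfl
    apply hP
    refine MvPolynomial.funext fun l => ?_
    have := hQ (fun e => if h : e = e₁ then 1 else l ⟨e, h⟩) (by simp)
    simp at this
    rw [map_zero, this]
    congr 2
    funext e
    simp [e.2]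
  · intro lam h hl h0
    apply h
    rw [hQ lam hl, h0, mul_zero]


theorem exists_linpoly (U : Type) [AddCommGroup U] [Module ℂ U] [FiniteDimensional ℂ U] :
    ∃ (Ψ : (Fin (Module.finrank ℂ U) → ℂ) ≃ₗ[ℂ] U)
      (p : (U →ₗ[ℂ] ℂ) → MvPolynomial (Fin (Module.finrank ℂ U)) ℂ),
      ∀ f z, MvPolynomial.eval z (p f) = f (Ψ z) := by
  let Ψ := (Module.finBasis ℂ U).equivFun.symm
  refine ⟨Ψ, fun f => ∑ i, MvPolynomial.C (f (Module.finBasis ℂ U i)) * MvPolynomial.X i, ?_⟩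
  intro f z
  simp [Ψ, Module.Basis.equivFun_symm_apply, mul_comm]

/-- The normalized fibre. -/
def SS {X Y E : Type} [AddCommGroup X] [Module ℂ X] [AddCommGroup Y] [Module ℂ Y]
    (α : E → X →ₗ[ℂ] ℂ) (β : E → Y →ₗ[ℂ] ℂ) (e₁ : E) (lam : {e : E // e ≠ e₁} → ℂ) :
    Set (X × Y) :=
  {xy | α e₁ xy.1 = 1 ∧ β e₁ xy.2 = 1 ∧ ∀ e : {e : E // e ≠ e₁}, α e.1 xy.1 * β e.1 xy.2 = lam e}

/-- The fibre normalized by a functional on `X`. -/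
def TT {X Y E : Type} [AddCommGroup X] [Module ℂ X] [AddCommGroup Y] [Module ℂ Y]
    (α : E → X →ₗ[ℂ] ℂ) (β : E → Y →ₗ[ℂ] ℂ) (ℓ : X →ₗ[ℂ] ℂ) (lam : E → ℂ) :
    Set (X × Y) :=
  {xy | ℓ xy.1 = 1 ∧ ∀ e : E, α e xy.1 * β e xy.2 = lam e}

section abs
variable {X Y E : Type} [AddCommGroup X] [Module ℂ X] [AddCommGroup Y] [Module ℂ Y]
    [FiniteDimensional ℂ X] [FiniteDimensional ℂ Y] [Finite E]
    (α : E → X →ₗ[ℂ] ℂ) (β : E → Y →ₗ[ℂ] ℂ) (e₁ : E) (ℓ : X →ₗ[ℂ] ℂ)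

theorem dim_bound (lam : {e : E // e ≠ e₁} → ℂ) (hfin : (SS α β e₁ lam).Finite)
    (hne : (SS α β e₁ lam).Nonempty) :
    Module.finrank ℂ (X × Y) ≤ Nat.card E + 1 := by
  obtain ⟨Ψ, p, hp⟩ := exists_linpoly (X × Y)
  let F : Option E → MvPolynomial (Fin (Module.finrank ℂ (X × Y))) ℂ := fun o =>
    match o with
    | none => p (α e₁ ∘ₗ LinearMap.fst ℂ X Y) - 1
    | some e => if h : e = e₁ then p (β e₁ ∘ₗ LinearMap.snd ℂ X Y) - 1 else
        p (α e ∘ₗ LinearMap.fst ℂ X Y) * p (β e ∘ₗ LinearMap.snd ℂ X Y) - MvPolynomial.C (lam ⟨e, h⟩)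
  have hF : {z | ∀ k, MvPolynomial.eval z (F k) = 0} = Ψ ⁻¹' (SS α β e₁ lam) := by
    ext z
    simp only [Set.mem_ofPred_eq, Set.mem_preimage, SS, Option.forall]
    constructor
    · rintro ⟨h1, h2⟩
      refine ⟨?_, ?_, ?_⟩
      · simpa [F, hp, sub_eq_zero] using h1
      · simpa [F, hp, sub_eq_zero] using h2 e₁
      · intro e
        simpa [F, hp, sub_eq_zero, e.2] using h2 e.1
    · rintro ⟨h1, h2, h3⟩
      refine ⟨?_, fun e => ?_⟩
      · simpa [F, hp, sub_eq_zero] using h1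
      · by_cases h : e = e₁
        · subst h
          simpa [F, hp, sub_eq_zero] using h2
        · simpa [F, hp, sub_eq_zero, h] using h3 ⟨e, h⟩
  obtain ⟨xy, hxy⟩ := hne
  have := card_le_of_finite_fiber F (by rw [hF]; exact hfin.preimage Ψ.injective.injOn) (Ψ.symm xy)
    (by
      have : Ψ.symm xy ∈ {z | ∀ k, MvPolynomial.eval z (F k) = 0} := by
        rw [hF]; simpa using hxy
      exact this)
  simpa [Finite.card_option] using this

theorem exists_avoid (hd : Module.finrank ℂ (X × Y) ≤ Nat.card E + 1) (hℓ : ℓ ≠ 0) :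
    ∃ Q : MvPolynomial E ℂ, Q ≠ 0 ∧ ∀ lam : E → ℂ, MvPolynomial.eval lam Q ≠ 0 →
      lam e₁ ≠ 0 → ∀ x y, (∀ e, α e x * β e y = lam e) → ℓ x ≠ 0 := by
  let g : X × Y →ₗ[ℂ] ℂ := ℓ ∘ₗ LinearMap.fst ℂ X Y
  have hg : g ≠ 0 := by
    intro h
    apply hℓ
    ext x
    simpa [g] using congrArg (fun f => f (x, 0)) h
  have hK : Module.finrank ℂ (LinearMap.ker g) < Module.finrank ℂ (X × Y) := by
    apply Submodule.finrank_lt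
    intro h
    exact hg (LinearMap.ker_eq_top.1 h)
  obtain ⟨Ψ, p, hp⟩ := exists_linpoly (LinearMap.ker g)
  let F : Option E → MvPolynomial (Fin (Module.finrank ℂ (LinearMap.ker g))) ℂ := fun o =>
    match o with
    | none => p ((α e₁ ∘ₗ LinearMap.fst ℂ X Y) ∘ₗ (LinearMap.ker g).subtype)
    | some e => p ((α e ∘ₗ LinearMap.fst ℂ X Y) ∘ₗ (LinearMap.ker g).subtype) *
        p ((β e ∘ₗ LinearMap.snd ℂ X Y) ∘ₗ (LinearMap.ker g).subtype)
  obtain ⟨Q', hQ', hQz⟩ := exists_relation F (by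
    simp only [Nat.card_eq_fintype_card, Fintype.card_fin, Finite.card_option]
    omega)
  have hpt : ∃ m : Option E → ℂ, MvPolynomial.eval m (MvPolynomial.X none * Q') ≠ 0 := by
    by_contra hcon
    push Not at hcon
    have : MvPolynomial.X none * Q' = 0 := MvPolynomial.funext fun m => by simpa using hcon m
    simp [hQ'] at this
  obtain ⟨m, hm⟩ := hpt
  simp only [map_mul, MvPolynomial.eval_X, ne_eq, mul_eq_zero, not_or] at hm
  obtain ⟨ht, hm⟩ := hm
  let h : Option E → MvPolynomial E ℂ := fun o => o.elim (MvPolynomial.C (m none)) MvPolynomial.X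
  have hev : ∀ lam : E → ℂ, MvPolynomial.eval lam (MvPolynomial.aeval h Q') =
      MvPolynomial.eval (fun o : Option E => o.elim (m none) lam) Q' := by
    intro lam
    have : (MvPolynomial.aeval lam).comp (MvPolynomial.aeval h) =
      (MvPolynomial.aeval (fun o : Option E => o.elim (m none) lam) : MvPolynomial (Option E) ℂ →ₐ[ℂ] ℂ) := by
      ext o
      cases o <;> simp [h]
    have h2 := congrArg (fun g => g Q') this
    simpa [MvPolynomial.aeval_eq_eval] using h2
  refine ⟨MvPolynomial.aeval h Q', ?_, ?_⟩
  · intro h0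
    have := hev (fun e => m (some e))
    rw [h0, map_zero] at this
    apply hm
    rw [this]
    congr 2
    funext o
    cases o <;> rfl
  · intro lam hlam hl1 x y hxy hx
    apply hlam
    rw [hev]
    have ha : α e₁ x ≠ 0 := by
      intro h0
      apply hl1
      rw [← hxy e₁, h0, zero_mul]
    set t := m none / α e₁ x with htdef
    have ht0 : t ≠ 0 := div_ne_zero ht ha
    have := hQz (Ψ.symm ⟨(t • x, t⁻¹ • y), by simp [g, hx]⟩)
    rw [← this]
    congr 2
    funext o
    cases o with
    | none => simp [F, hp, htdef, ha]
    | some e =>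
      simp [F, hp, ← hxy e]
      field_simp

theorem main_abs (hℓ : ℓ ≠ 0) (N : ℕ) (P : MvPolynomial {e : E // e ≠ e₁} ℂ) (hP : P ≠ 0)
    (h : ∀ lam, MvPolynomial.eval lam P ≠ 0 →
      (SS α β e₁ lam).Finite ∧ Nat.card (SS α β e₁ lam) = N) :
    ∃ Q : MvPolynomial E ℂ, Q ≠ 0 ∧ ∀ lam : E → ℂ, MvPolynomial.eval lam Q ≠ 0 →
      (TT α β ℓ lam).Finite ∧ Nat.card (TT α β ℓ lam) = N := by
  obtain ⟨Q₁, hQ₁, hQ₁'⟩ := exists_homog e₁ P hP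
  have h2 : ∃ Q : MvPolynomial E ℂ, Q ≠ 0 ∧ ∀ lam : E → ℂ, MvPolynomial.eval lam Q ≠ 0 →
      lam e₁ ≠ 0 → MvPolynomial.eval (fun e : {e : E // e ≠ e₁} => lam e.1 / lam e₁) P ≠ 0 →
      ∀ xy ∈ SS α β e₁ (fun e : {e : E // e ≠ e₁} => lam e.1 / lam e₁), ℓ xy.1 ≠ 0 := by
    by_cases hN : ∃ lam, MvPolynomial.eval lam P ≠ 0 ∧ (SS α β e₁ lam).Nonempty
    · obtain ⟨lam, hl, hne⟩ := hN
      obtain ⟨Q, hQ, hQ'⟩ := exists_avoid α β e₁ ℓ (dim_bound α β e₁ lam (h lam hl).1 hne) hℓ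
      refine ⟨Q, hQ, fun lam hl hl1 _ xy hxy => ?_⟩
      refine hQ' lam hl hl1 xy.1 (lam e₁ • xy.2) fun e => ?_
      by_cases he : e = e₁
      · subst he
        simp [hxy.1, hxy.2.1]
      · have := hxy.2.2 ⟨e, he⟩
        simp only at this
        simp only [map_smul, smul_eq_mul]
        rw [mul_left_comm, this]
        field_simp
    · push Not at hN
      refine ⟨1, one_ne_zero, fun lam _ _ hp xy hxy => ?_⟩
      rw [hN _ hp] at hxy
      exact hxy.elim
  obtain ⟨Q₂, hQ₂, hQ₂'⟩ := h2
  refine ⟨MvPolynomial.X e₁ * (Q₁ * Q₂), by simp [hQ₁, hQ₂], fun lam hl => ?_⟩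
  simp only [map_mul, MvPolynomial.eval_X, ne_eq, mul_eq_zero, not_or] at hl
  obtain ⟨hl1, hlQ₁, hlQ₂⟩ := hl
  have hPl := hQ₁' lam hlQ₁ hl1
  have hav := hQ₂' lam hlQ₂ hl1 hPl
  obtain ⟨hfin, hcard⟩ := h _ hPl
  set S := SS α β e₁ (fun e : {e : E // e ≠ e₁} => lam e.1 / lam e₁) with hS
  have hT : TT α β ℓ lam =
      (fun xy : X × Y => ((ℓ xy.1)⁻¹ • xy.1, (lam e₁ * ℓ xy.1) • xy.2)) '' S := by
    ext ⟨x, y⟩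
    constructor
    · rintro ⟨hx, hxy⟩
      simp only at hx hxy
      have h1 := hxy e₁
      have ha : α e₁ x ≠ 0 := by
        intro h0
        apply hl1
        rw [← h1, h0, zero_mul]
      have hb : β e₁ y ≠ 0 := by
        intro h0
        apply hl1
        rw [← h1, h0, mul_zero]
      refine ⟨((α e₁ x)⁻¹ • x, (β e₁ y)⁻¹ • y), ⟨?_, ?_, ?_⟩, ?_⟩
      · simp [ha]
      · simp [hb]
      · intro e
        simp only [map_smul, smul_eq_mul]
        rw [← hxy e.1, ← h1]
        field_simp
      · simp only [map_smul, smul_eq_mul, hx, mul_one, inv_inv, smul_smul, Prod.mk.injEq]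
        rw [← h1]
        constructor
        · rw [mul_inv_cancel₀ ha, one_smul]
        · have : α e₁ x * β e₁ y * (α e₁ x)⁻¹ * (β e₁ y)⁻¹ = 1 := by field_simp
          rw [this, one_smul]
    · rintro ⟨⟨x', y'⟩, hxy', he⟩
      have hne := hav _ hxy'
      obtain ⟨h1, h2, h3⟩ := hxy'
      simp only [Prod.mk.injEq] at h1 h2 h3 he hne
      obtain ⟨rfl, rfl⟩ := he
      refine ⟨?_, ?_⟩
      · simp [hne]
      · intro e
        simp only [map_smul, smul_eq_mul]
        have : (ℓ x')⁻¹ * α e x' * (lam e₁ * ℓ x' * β e y') = lam e₁ * (α e x' * β e y') := by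
          field_simp
        rw [this]
        by_cases he : e = e₁
        · subst he
          simp [h1, h2]
        · rw [h3 ⟨e, he⟩]
          field_simp
  have hinj : Set.InjOn (fun xy : X × Y => ((ℓ xy.1)⁻¹ • xy.1, (lam e₁ * ℓ xy.1) • xy.2)) S := by
    rintro ⟨x, y⟩ hxy ⟨x', y'⟩ hxy' he
    have hne := hav _ hxy
    have hne' := hav _ hxy'
    simp only [Prod.mk.injEq] at he hne hne'
    have h1 : α e₁ x = 1 := hxy.1
    have h1' : α e₁ x' = 1 := hxy'.1
    have h2 := congrArg (α e₁) he.1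
    simp [h1, h1'] at h2
    rw [h2] at he
    have e1 := smul_right_injective X (inv_ne_zero hne') he.1
    have e2 := smul_right_injective Y (mul_ne_zero hl1 hne') he.2
    exact Prod.ext e1 e2
  rw [hT]
  refine ⟨hfin.image _, ?_⟩
  rw [Nat.card_image_of_injOn hinj, hcard]
end abs

section graph
variable {V : Type}

/-- Differences of a potential along a set of pairs. -/
def DD (A : Set (V × V)) : (V → ℂ) →ₗ[ℂ] (A → ℂ) where
  toFun φ := fun p => φ p.1.2 - φ p.1.1
  map_add' := by
    intro a b
    funext p
    simp only [Pi.add_apply]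
    ring
  map_smul' := by
    intro c a
    funext p
    simp only [Pi.smul_apply, smul_eq_mul, RingHom.id_apply]
    ring

/-- Walks with their sums. -/
inductive Wk {A : Set (V × V)} (x : A → ℂ) : V → V → ℂ → Prop
  | nil (u : V) : Wk x u u 0
  | cons (u w v : V) (s : ℂ) (h : (u, w) ∈ A) : Wk x w v s → Wk x u v (x ⟨(u, w), h⟩ + s)

theorem Wk.exists_walk {A : Set (V × V)} {x : A → ℂ} {u v : V} {s : ℂ} (h : Wk x u v s) :
    ∃ (n : ℕ) (f : ℕ → V) (w : Fin n → A),
      (∀ i : Fin n, (w i : V × V) = (f i.1, f (i.1 + 1))) ∧ f 0 = u ∧ f n = v ∧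
        ∑ i, x (w i) = s := by
  induction h with
  | nil u => exact ⟨0, fun _ => u, Fin.elim0, fun i => i.elim0, rfl, rfl, by simp⟩
  | cons u w v s h _ ih =>
    obtain ⟨n, f, p, hp, h0, hn, hs⟩ := ih
    refine ⟨n + 1, fun k => Nat.casesOn k u f, Fin.cons ⟨(u, w), h⟩ p, ?_, rfl, hn, ?_⟩
    · intro i
      refine Fin.cases ?_ (fun j => ?_) i
      · simp [h0]
      · simpa using hp j
    · simp [Fin.sum_univ_succ, hs]

theorem Wk.append {A : Set (V × V)} {x : A → ℂ} {u v w : V} {s t : ℂ} (h : Wk x u v s)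
    (h' : Wk x v w t) : Wk x u w (s + t) := by
  induction h with
  | nil u => simpa using h'
  | cons u w v s h _ ih =>
    rw [add_assoc]
    exact Wk.cons _ _ _ _ h (ih h')

theorem closed_iff (A : Set (V × V)) (hsym : ∀ u v, (u, v) ∈ A → (v, u) ∈ A) (x : A → ℂ) :
    (∀ (n : ℕ) (u : ℕ → V) (w : Fin n → A),
      (∀ i : Fin n, (w i : V × V) = (u i.1, u (i.1 + 1))) → u n = u 0 →
      ∑ i, x (w i) = 0) ↔ x ∈ LinearMap.range (DD A) := by
  constructor
  · intro hcl
    have hW : ∀ u s, Wk x u u s → s = 0 := by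
      intro u s h
      obtain ⟨n, f, w, hw, h0, hn, hs⟩ := h.exists_walk
      rw [← hs]
      exact hcl n f w hw (by rw [h0, hn])
    have hone : ∀ u v (h : (u, v) ∈ A), Wk x u v (x ⟨(u, v), h⟩) := by
      intro u v h
      simpa using Wk.cons u v v 0 h (Wk.nil v)
    have hrev : ∀ u v s, Wk x u v s → Wk x v u (-s) := by
      intro u v s h
      induction h with
      | nil u => simpa using Wk.nil u
      | cons u w v s h _ ih =>
        have h1 := hone w u (hsym u w h)
        have h2 := hW _ _ ((hone u w h).append h1)
        have h3 := ih.append h1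
        have : -(x ⟨(u, w), h⟩ + s) = -s + x ⟨(w, u), hsym u w h⟩ := by
          linear_combination -h2
        rwa [this]
    let st : Setoid V := ⟨fun u v => ∃ s, Wk x u v s, ⟨fun u => ⟨0, Wk.nil u⟩,
      fun ⟨s, h⟩ => ⟨-s, hrev _ _ _ h⟩, fun ⟨s, h⟩ ⟨t, h'⟩ => ⟨s + t, h.append h'⟩⟩⟩
    let r : V → V := fun v => (Quotient.mk st v).out
    have hr : ∀ v, ∃ s, Wk x (r v) v s := fun v => Quotient.mk_out (s := st) v
    choose φ hφ using hr
    refine ⟨φ, ?_⟩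
    funext ⟨⟨u, v⟩, h⟩
    have huv : r u = r v := by
      simp only [r]
      congr 1
      exact Quotient.sound (s := st) ⟨_, hone u v h⟩
    have h1 := hφ u
    rw [huv] at h1
    have := hW _ _ ((h1.append (hone u v h)).append (hrev _ _ _ (hφ v)))
    simp only [DD, LinearMap.coe_mk, AddHom.coe_mk]
    linear_combination -this
  · rintro ⟨φ, rfl⟩ n u w hw hn
    have : ∀ i : Fin n, (DD A φ) (w i) = (fun k : ℕ => φ (u (k + 1)) - φ (u k)) i.1 := by
      intro i
      simp [DD, hw i]
    rw [Finset.sum_congr rfl fun i _ => this i, Fin.sum_univ_eq_sum_range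
      (fun k : ℕ => φ (u (k + 1)) - φ (u k)), Finset.sum_range_sub (fun k => φ (u k)), hn, sub_self]

theorem eqvGen_of_not_bridge {E : Type} [Finite V] (τ : E → Sym2 V) (e : E) (h : ¬ IsBridge τ e)
    (u v : V) (huv : τ e = s(u, v)) :
    Relation.EqvGen (adjRel (deleteEnds τ ({e} : Set E))) u v := by
  let f : Quotient (ccSetoid (deleteEnds τ ({e} : Set E))) → Quotient (ccSetoid τ) :=
    Quotient.map' id (by
      intro a b hab
      have hab' : Relation.EqvGen (adjRel (deleteEnds τ ({e} : Set E))) a b := hab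
      show Relation.EqvGen (adjRel τ) a b
      induction hab' with
      | rel a b h =>
        obtain ⟨e', he'⟩ := h
        exact Relation.EqvGen.rel _ _ ⟨e'.1, he'⟩
      | refl a => exact Relation.EqvGen.refl _
      | symm a b h ih => exact Relation.EqvGen.symm _ _ (ih h)
      | trans a b c h h' ih1 ih2 => exact Relation.EqvGen.trans _ _ _ (ih1 h) (ih2 h'))
  have hs : Function.Surjective f := by
    intro q
    induction q using Quotient.inductionOn with
    | h a => exact ⟨Quotient.mk _ a, rfl⟩
  unfold IsBridge numCC at h
  have hb : Function.Bijective f := by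
    have := Fintype.ofFinite (Quotient (ccSetoid (deleteEnds τ ({e} : Set E))))
    have := Fintype.ofFinite (Quotient (ccSetoid τ))
    rw [Fintype.bijective_iff_surjective_and_card]
    refine ⟨hs, ?_⟩
    rw [← Nat.card_eq_fintype_card, ← Nat.card_eq_fintype_card]
    exact le_antisymm (not_lt.1 h) (Nat.card_le_card_of_surjective f hs)
  have : f (Quotient.mk _ u) = f (Quotient.mk _ v) :=
    Quotient.sound (s := ccSetoid τ) (Relation.EqvGen.rel _ _ ⟨e, huv⟩)
  exact Quotient.exact (hb.1 this)

theorem exists_factor {U U' : Type} [AddCommGroup U] [Module ℂ U] [AddCommGroup U'] [Module ℂ U']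
    (f : U →ₗ[ℂ] U') (g : U →ₗ[ℂ] ℂ) (h : ∀ u, f u = 0 → g u = 0) :
    ∃ ℓ : LinearMap.range f →ₗ[ℂ] ℂ, ∀ u, ℓ ⟨f u, ⟨u, rfl⟩⟩ = g u := by
  refine ⟨(LinearMap.ker f).liftQ g (fun u hu => h u hu) ∘ₗ f.quotKerEquivRange.symm.toLinearMap, ?_⟩
  intro u
  have := f.quotKerEquivRange_symm_apply_image u ⟨u, rfl⟩
  simp only [LinearMap.comp_apply, LinearEquiv.coe_coe]
  rw [this]
  rfl

/-- One side of the untangling: the functional extending to the deleted edge. -/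
theorem exists_ell {E : Type} [Finite V] (τ : E → Sym2 V) (ebar : E) (h : ¬ IsBridge τ ebar)
    (u v : V) (huv : τ ebar = s(u, v)) (hne : u ≠ v) (E1 E2 : Set E) (V1 : Set V)
    (hE : ∀ e, e = ebar ∨ e ∈ E1 ∨ e ∈ E2)
    (h1 : ∀ e ∈ E1, ∀ v, v ∈ τ e → v ∈ V1) (hb : ∀ v, v ∈ τ ebar → v ∈ V1)
    (h2 : ∀ e ∈ E2, ∀ v, v ∈ τ e → v ∉ V1) (A : Set (V × V))
    (hA : ∀ e ∈ E1, ∀ a b, a ≠ b → τ e = s(a, b) → (a, b) ∈ A) :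
    ∃ ℓ : LinearMap.range (DD A) →ₗ[ℂ] ℂ, ℓ ≠ 0 ∧ ∀ φ, ℓ ⟨DD A φ, ⟨φ, rfl⟩⟩ = φ v - φ u := by
  obtain ⟨ℓ, hℓ⟩ := exists_factor (DD A) 
    ((LinearMap.proj v : (V → ℂ) →ₗ[ℂ] ℂ) - (LinearMap.proj u : (V → ℂ) →ₗ[ℂ] ℂ)) (by
    intro φ hφ
    have huv' := eqvGen_of_not_bridge τ ebar h u v huv
    have key : ∀ a b, Relation.EqvGen (adjRel (deleteEnds τ ({ebar} : Set E))) a b →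
        (if a ∈ V1 then φ a else 0) = (if b ∈ V1 then φ b else 0) := by
      intro a b hab
      induction hab with
      | rel a b hab =>
        obtain ⟨⟨e, he⟩, hab⟩ := hab
        simp only [deleteEnds] at hab
        rcases hE e with rfl | he1 | he2
        · simp at he
        · rw [if_pos (h1 e he1 a (by rw [hab]; simp)), if_pos (h1 e he1 b (by rw [hab]; simp))]
          by_cases hab' : a = b
          · rw [hab']
          · have := congrFun hφ ⟨(a, b), hA e he1 a b hab' hab⟩
            simp only [DD, LinearMap.coe_mk, AddHom.coe_mk, Pi.zero_apply] at this
            linear_combination -this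
        · rw [if_neg (h2 e he2 a (by rw [hab]; simp)), if_neg (h2 e he2 b (by rw [hab]; simp))]
      | refl a => rfl
      | symm a b _ ih => exact ih.symm
      | trans a b c _ _ ih1 ih2 => exact ih1.trans ih2
    have := key u v huv'
    rw [if_pos (hb u (by rw [huv]; simp)), if_pos (hb v (by rw [huv]; simp))] at this
    rw [LinearMap.sub_apply]
    exact sub_eq_zero.2 this.symm)
  refine ⟨ℓ, ?_, hℓ⟩
  rintro rfl
  have : (0 : ℂ) = (Pi.single v 1 : V → ℂ) v - (Pi.single v 1 : V → ℂ) u := hℓ (Pi.single v 1)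
  simp [hne] at this

end graph

namespace Bigraph
variable (B : Bigraph)

theorem s_min_max {V : Type} [LinearOrder V] (s : Sym2 V) : s = s(sMin s, sMax s) := by
  induction s using Sym2.ind with
  | _ x y =>
    simp only [sMin, sMax, Sym2.lift_mk]
    rcases le_total x y with h | h
    · simp [h]
    · simp [h, Sym2.eq_swap]

theorem τG_eq (e : B.ℰ) : B.τG e = s(B.eFstG e, B.eSndG e) := by
  letI := B.ordV
  exact s_min_max _

theorem τH_eq (e : B.ℰ) : B.τH e = s(B.eFstH e, B.eSndH e) := by
  letI := B.ordW
  exact s_min_max _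

theorem neG (hl : ¬ B.HasLoop) (e : B.ℰ) : B.eFstG e ≠ B.eSndG e := by
  intro h
  apply hl
  left
  refine ⟨e, ?_⟩
  rw [τG_eq, h]
  simp

theorem neH (hl : ¬ B.HasLoop) (e : B.ℰ) : B.eFstH e ≠ B.eSndH e := by
  intro h
  apply hl
  right
  refine ⟨e, ?_⟩
  rw [τH_eq, h]
  simp

abbrev XG := LinearMap.range (DD B.Pset)
abbrev XH := LinearMap.range (DD B.Qset)

def pG (hl : ¬ B.HasLoop) (e : B.ℰ) : B.Pset := ⟨(B.eFstG e, B.eSndG e), B.neG hl e, e, B.τG_eq e⟩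
def pH (hl : ¬ B.HasLoop) (e : B.ℰ) : B.Qset := ⟨(B.eFstH e, B.eSndH e), B.neH hl e, e, B.τH_eq e⟩

def aG (hl : ¬ B.HasLoop) (e : B.ℰ) : B.XG →ₗ[ℂ] ℂ :=
  LinearMap.proj (B.pG hl e) ∘ₗ (LinearMap.range (DD B.Pset)).subtype
def aH (hl : ¬ B.HasLoop) (e : B.ℰ) : B.XH →ₗ[ℂ] ℂ :=
  LinearMap.proj (B.pH hl e) ∘ₗ (LinearMap.range (DD B.Qset)).subtype

theorem Psym (u v : B.V) (h : (u, v) ∈ B.Pset) : (v, u) ∈ B.Pset := by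
  obtain ⟨h1, e, he⟩ := h
  exact ⟨h1.symm, e, by rw [he]; exact Sym2.eq_swap⟩

theorem Qsym (u v : B.W) (h : (u, v) ∈ B.Qset) : (v, u) ∈ B.Qset := by
  obtain ⟨h1, e, he⟩ := h
  exact ⟨h1.symm, e, by rw [he]; exact Sym2.eq_swap⟩

theorem ZSet_eq (hl : ¬ B.HasLoop) (ebar : B.ℰ) (lam : {e : B.ℰ // e ≠ ebar} → ℂ) :
    B.ZSet ebar lam = (fun xy : B.XG × B.XH => (xy.1.1, xy.2.1)) ''
      SS (B.aG hl) (B.aH hl) ebar lam := by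
  ext ⟨x, y⟩
  constructor
  · rintro ⟨h1, h2, h3, h4, h5⟩
    refine ⟨(⟨x, (closed_iff _ B.Psym x).1 h4⟩, ⟨y, (closed_iff _ B.Qsym y).1 h5⟩), ⟨?_, ?_, ?_⟩, rfl⟩
    · exact h1 _ rfl
    · exact h2 _ rfl
    · intro e
      exact h3 e _ _ rfl rfl
  · rintro ⟨⟨x', y'⟩, ⟨h1, h2, h3⟩, h⟩
    simp only [Prod.mk.injEq] at h
    obtain ⟨rfl, rfl⟩ := h
    refine ⟨?_, ?_, ?_, (closed_iff _ B.Psym _).2 x'.2, (closed_iff _ B.Qsym _).2 y'.2⟩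
    · intro p hp
      have : p = B.pG hl ebar := Subtype.ext hp
      rw [this]; exact h1
    · intro p hp
      have : p = B.pH hl ebar := Subtype.ext hp
      rw [this]; exact h2
    · intro e p q hp hq
      have e1 : p = B.pG hl e.1 := Subtype.ext hp
      have e2 : q = B.pH hl e.1 := Subtype.ext hq
      rw [e1, e2]; exact h3 e

theorem inj_aux : Function.Injective
    (fun xy : B.XG × B.XH => ((xy.1.1, xy.2.1) : (B.Pset → ℂ) × (B.Qset → ℂ))) := by
  rintro ⟨x, y⟩ ⟨x', y'⟩ h
  simp only [Prod.mk.injEq] at h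
  exact Prod.ext (Subtype.ext h.1) (Subtype.ext h.2)

theorem ZSet_fin (hl : ¬ B.HasLoop) (ebar : B.ℰ) (lam : {e : B.ℰ // e ≠ ebar} → ℂ) (N : ℕ) :
    ((B.ZSet ebar lam).Finite ∧ Nat.card (B.ZSet ebar lam) = N) ↔
      ((SS (B.aG hl) (B.aH hl) ebar lam).Finite ∧
        Nat.card (SS (B.aG hl) (B.aH hl) ebar lam) = N) := by
  rw [ZSet_eq B hl, Set.finite_image_iff B.inj_aux.injOn, Nat.card_image_of_injective B.inj_aux]

theorem SS_swap_fin {X Y E : Type} [AddCommGroup X] [Module ℂ X] [AddCommGroup Y] [Module ℂ Y]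
    (α : E → X →ₗ[ℂ] ℂ) (β : E → Y →ₗ[ℂ] ℂ) (e₁ : E) (lam : {e : E // e ≠ e₁} → ℂ) (N : ℕ)
    (h : (SS α β e₁ lam).Finite ∧ Nat.card (SS α β e₁ lam) = N) :
    (SS β α e₁ lam).Finite ∧ Nat.card (SS β α e₁ lam) = N := by
  have : SS β α e₁ lam = Prod.swap '' SS α β e₁ lam := by
    ext ⟨y, x⟩
    simp only [SS, Set.mem_image, Prod.exists, Prod.swap_prod_mk, Prod.mk.injEq, Set.mem_ofPred_eq]
    constructor
    · rintro ⟨h1, h2, h3⟩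
      exact ⟨x, y, ⟨h2, h1, fun e => by rw [mul_comm]; exact h3 e⟩, rfl, rfl⟩
    · rintro ⟨x, y, ⟨h1, h2, h3⟩, rfl, rfl⟩
      exact ⟨h2, h1, fun e => by rw [mul_comm]; exact h3 e⟩
  rw [this, Nat.card_image_of_injective Prod.swap_injective]
  exact ⟨h.1.image _, h.2⟩

theorem restrict_noLoop (hl : ¬ B.HasLoop) (S : Set B.ℰ) : ¬ (B.restrict S).HasLoop := by
  rintro (⟨e, he⟩ | ⟨e, he⟩)
  · exact hl (Or.inl ⟨e.1, he⟩)
  · exact hl (Or.inr ⟨e.1, he⟩)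

end Bigraph
/-- Restriction of difference vectors to a smaller set of pairs. -/
def res {V : Type} {A A' : Set (V × V)} (h : A ⊆ A') (x : LinearMap.range (DD A')) :
    LinearMap.range (DD A) :=
  ⟨fun p => x.1 ⟨p.1, h p.2⟩, by
    obtain ⟨x, φ, rfl⟩ := x
    exact ⟨φ, rfl⟩⟩

theorem restrict_Pset (B : Bigraph) (S : Set B.ℰ) : (B.restrict S).Pset ⊆ B.Pset := by
  rintro p ⟨h, e, he⟩
  exact ⟨h, e.1, he⟩

theorem restrict_Qset (B : Bigraph) (S : Set B.ℰ) : (B.restrict S).Qset ⊆ B.Qset := by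
  rintro p ⟨h, e, he⟩
  exact ⟨h, e.1, he⟩

/-- Two difference vectors that agree on the pieces and on the distinguished pair agree. -/
theorem ext_aux {V E : Type} (τ : E → Sym2 V) (ebar : E) (E1 E2 : Set E) (u v : V)
    (huv : τ ebar = s(u, v))
    (hE : ∀ e, e = ebar ∨ e ∈ E1 ∨ e ∈ E2) (A A1 A2 : Set (V × V))
    (hA : ∀ p ∈ A, p.1 ≠ p.2 ∧ ∃ e, τ e = s(p.1, p.2))
    (hA1 : ∀ e ∈ E1, ∀ a b, a ≠ b → τ e = s(a, b) → (a, b) ∈ A1)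
    (hA2 : ∀ e ∈ E2, ∀ a b, a ≠ b → τ e = s(a, b) → (a, b) ∈ A2)
    (h1 : A1 ⊆ A) (h2 : A2 ⊆ A) (x y : LinearMap.range (DD A)) (huvA : (u, v) ∈ A)
    (hxy : x.1 ⟨(u, v), huvA⟩ = y.1 ⟨(u, v), huvA⟩)
    (hr1 : res h1 x = res h1 y) (hr2 : res h2 x = res h2 y) : x = y := by
  obtain ⟨x, φ, rfl⟩ := x
  obtain ⟨y, ψ, rfl⟩ := y
  apply Subtype.ext
  funext ⟨⟨a, b⟩, hp⟩
  obtain ⟨hab, e, he⟩ := hA _ hp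
  simp only at hab he
  have hxy' : φ v - φ u = ψ v - ψ u := hxy
  show φ b - φ a = ψ b - ψ a
  rcases hE e with rfl | h | h
  · rw [huv, Sym2.eq_iff] at he
    rcases he with ⟨rfl, rfl⟩ | ⟨rfl, rfl⟩
    · exact hxy'
    · linear_combination -hxy'
  · exact congrFun (congrArg Subtype.val hr1) ⟨(a, b), hA1 e h a b hab he⟩
  · exact congrFun (congrArg Subtype.val hr2) ⟨(a, b), hA2 e h a b hab he⟩

theorem glue_aux {V : Type} (V1 : Set V) (A A1 A2 : Set (V × V))
    (h1 : A1 ⊆ A) (h2 : A2 ⊆ A) (hA1 : ∀ p ∈ A1, p.1 ∈ V1 ∧ p.2 ∈ V1)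
    (hA2 : ∀ p ∈ A2, p.1 ∉ V1 ∧ p.2 ∉ V1) (φ₁ φ₂ : V → ℂ) :
    ∃ φ : V → ℂ, (∀ v ∈ V1, φ v = φ₁ v) ∧ (∀ v, v ∉ V1 → φ v = φ₂ v) ∧
      res h1 ⟨DD A φ, φ, rfl⟩ = ⟨DD A1 φ₁, φ₁, rfl⟩ ∧
      res h2 ⟨DD A φ, φ, rfl⟩ = ⟨DD A2 φ₂, φ₂, rfl⟩ := by
  refine ⟨fun v => if v ∈ V1 then φ₁ v else φ₂ v, fun v hv => by simp [hv],
    fun v hv => by simp [hv], ?_, ?_⟩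
  · apply Subtype.ext
    funext ⟨p, hp⟩
    simp [res, DD, hA1 p hp]
  · apply Subtype.ext
    funext ⟨p, hp⟩
    simp [res, DD, hA2 p hp]

/-- If `B` untangles via `ē` into `B₁` and `B₂` and `ē` is neither a
bridge in `G` nor in `H`, then `Lam(B) = Lam(B₁) · Lam(B₂)`. -/
theorem statement10 (B : Bigraph) (hloop : ¬ B.HasLoop) (ebar : B.ℰ)
    (E1 E2 : Set B.ℰ) (V1 V2 : Set B.V) (W1 W2 : Set B.W)
    (hun : B.Untangles ebar E1 E2 V1 V2 W1 W2)
    (hbG : ¬ IsBridge B.τG ebar) (hbH : ¬ IsBridge B.τH ebar)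
    (N₁ N₂ : ℕ)
    (h1 : ∃ e₁ : (B.restrict E1).ℰ, (B.restrict E1).HasLamanNumber e₁ N₁)
    (h2 : ∃ e₂ : (B.restrict E2).ℰ, (B.restrict E2).HasLamanNumber e₂ N₂) :
    B.HasLamanNumber ebar (N₁ * N₂) := by
  obtain ⟨hb1, hb2, -, hE, hV12, hV, hG1, hGb, hG2, hW12, hW, hH1, hH2, hHb⟩ := hun
  obtain ⟨e₁, h1⟩ := h1
  obtain ⟨e₂, h2⟩ := h2
  have hl1 := B.restrict_noLoop hloop E1
  have hl2 := B.restrict_noLoop hloop E2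
  rcases h1 with ⟨h, -⟩ | ⟨-, P₁, hP₁, h1⟩
  · exact absurd h hl1
  rcases h2 with ⟨h, -⟩ | ⟨-, P₂, hP₂, h2⟩
  · exact absurd h hl2
  have hV2 : ∀ v ∈ V2, v ∉ V1 := fun v hv hv1 => by
    have : v ∈ V1 ∩ V2 := ⟨hv1, hv⟩
    rw [hV12] at this
    exact this
  have hW2 : ∀ v ∈ W1, v ∉ W2 := fun v hv hv1 => by
    have : v ∈ W1 ∩ W2 := ⟨hv, hv1⟩
    rw [hW12] at this
    exact this
  have hPin : ∀ S : Set B.ℰ, ∀ e ∈ S, ∀ a b : B.V, a ≠ b → B.τG e = s(a, b) →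
      (a, b) ∈ (B.restrict S).Pset := fun S e he a b hab h => ⟨hab, ⟨e, he⟩, h⟩
  have hQin : ∀ S : Set B.ℰ, ∀ e ∈ S, ∀ a b : B.W, a ≠ b → B.τH e = s(a, b) →
      (a, b) ∈ (B.restrict S).Qset := fun S e he a b hab h => ⟨hab, ⟨e, he⟩, h⟩
  obtain ⟨ℓ₁, hℓ₁, hℓ₁'⟩ := exists_ell B.τG ebar hbG _ _ (B.τG_eq ebar) (B.neG hloop ebar) E1 E2 V1
    hE hG1 hGb (fun e he v hv => hV2 v (hG2 e he v hv)) (B.restrict E1).Pset (hPin E1)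
  obtain ⟨ℓ₂, hℓ₂, hℓ₂'⟩ := exists_ell B.τH ebar hbH _ _ (B.τH_eq ebar) (B.neH hloop ebar) E2 E1 W2
    (fun e => (hE e).imp_right Or.symm) hH2 hHb (fun e he v hv => hW2 v (hH1 e he v hv))
    (B.restrict E2).Qset (hQin E2)
  obtain ⟨Q₁, hQ₁, hQ₁'⟩ := main_abs ((B.restrict E1).aG hl1) ((B.restrict E1).aH hl1) e₁ ℓ₁ hℓ₁ N₁ P₁
    hP₁ (fun lam hlam => ((B.restrict E1).ZSet_fin hl1 e₁ lam N₁).1 (h1 lam hlam))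
  obtain ⟨Q₂, hQ₂, hQ₂'⟩ := main_abs ((B.restrict E2).aH hl2) ((B.restrict E2).aG hl2) e₂ ℓ₂ hℓ₂ N₂ P₂
    hP₂ (fun lam hlam => Bigraph.SS_swap_fin _ _ _ _ _
      (((B.restrict E2).ZSet_fin hl2 e₂ lam N₂).1 (h2 lam hlam)))
  let i₁ : (B.restrict E1).ℰ → {e : B.ℰ // e ≠ ebar} := fun e => ⟨e.1, fun h => hb1 (h ▸ e.2)⟩
  let i₂ : (B.restrict E2).ℰ → {e : B.ℰ // e ≠ ebar} := fun e => ⟨e.1, fun h => hb2 (h ▸ e.2)⟩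
  have hi₁ : Function.Injective i₁ := fun a b h => Subtype.ext (congrArg (fun z => z.1) h)
  have hi₂ : Function.Injective i₂ := fun a b h => Subtype.ext (congrArg (fun z => z.1) h)
  refine Or.inr ⟨hloop, MvPolynomial.rename i₁ Q₁ * MvPolynomial.rename i₂ Q₂, ?_, ?_⟩
  · refine mul_ne_zero ?_ ?_
    · intro h
      exact hQ₁ (MvPolynomial.rename_injective i₁ hi₁ (by rw [h, map_zero]))
    · intro h
      exact hQ₂ (MvPolynomial.rename_injective i₂ hi₂ (by rw [h, map_zero]))
  intro lam hlam
  rw [map_mul, MvPolynomial.eval_rename, MvPolynomial.eval_rename] at hlam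
  obtain ⟨hf1, hc1⟩ := hQ₁' _ (left_ne_zero_of_mul hlam)
  obtain ⟨hf2, hc2⟩ := hQ₂' _ (right_ne_zero_of_mul hlam)
  rw [B.ZSet_fin hloop]
  set T₁ := TT ((B.restrict E1).aG hl1) ((B.restrict E1).aH hl1) ℓ₁ (lam ∘ i₁) with hT₁
  set T₂ := TT ((B.restrict E2).aH hl2) ((B.restrict E2).aG hl2) ℓ₂ (lam ∘ i₂) with hT₂
  have p1 := restrict_Pset B E1
  have p2 := restrict_Pset B E2
  have q1 := restrict_Qset B E1
  have q2 := restrict_Qset B E2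
  let r : B.XG × B.XH → ((B.restrict E1).XG × (B.restrict E1).XH) ×
      ((B.restrict E2).XH × (B.restrict E2).XG) := fun xy =>
    ((res p1 xy.1, res q1 xy.2), (res q2 xy.2, res p2 xy.1))
  have hinj : Set.InjOn r (SS (B.aG hloop) (B.aH hloop) ebar lam) := by
    rintro ⟨x, y⟩ ⟨hx, hy, -⟩ ⟨x', y'⟩ ⟨hx', hy', -⟩ h
    simp only [r, Prod.mk.injEq] at h
    obtain ⟨⟨a1, a2⟩, a3, a4⟩ := h
    refine Prod.ext ?_ ?_
    · exact ext_aux B.τG ebar E1 E2 _ _ (B.τG_eq ebar) hE B.Pset _ _ (fun p hp => hp)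
        (hPin E1) (hPin E2) p1 p2 x x' (B.pG hloop ebar).2 (hx.trans hx'.symm) a1 a4
    · exact ext_aux B.τH ebar E1 E2 _ _ (B.τH_eq ebar) hE B.Qset _ _ (fun p hp => hp)
        (hQin E1) (hQin E2) q1 q2 y y' (B.pH hloop ebar).2 (hy.trans hy'.symm) a2 a3
  have himg : r '' (SS (B.aG hloop) (B.aH hloop) ebar lam) = T₁ ×ˢ T₂ := by
    ext ⟨⟨x₁, y₁⟩, ⟨y₂, x₂⟩⟩
    constructor
    · rintro ⟨⟨x, y⟩, ⟨hx, hy, hxy⟩, h⟩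
      simp only [r, Prod.mk.injEq] at h
      obtain ⟨⟨rfl, rfl⟩, rfl, rfl⟩ := h
      refine ⟨⟨?_, ?_⟩, ?_, ?_⟩
      · obtain ⟨x, φ, rfl⟩ := x
        exact (hℓ₁' φ).trans hx
      · intro e
        exact hxy (i₁ e)
      · obtain ⟨y, ψ, rfl⟩ := y
        exact (hℓ₂' ψ).trans hy
      · intro e
        exact (mul_comm _ _).trans (hxy (i₂ e))
    · rintro ⟨⟨hx, hxy₁⟩, hy, hxy₂⟩
      obtain ⟨x₁, φ₁, rfl⟩ := x₁
      obtain ⟨x₂, φ₂, rfl⟩ := x₂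
      obtain ⟨y₁, ψ₁, rfl⟩ := y₁
      obtain ⟨y₂, ψ₂, rfl⟩ := y₂
      obtain ⟨φ, hφ1, hφ2, hr1, hr2⟩ := glue_aux V1 B.Pset _ _ p1 p2
        (by
          rintro p ⟨-, e, he⟩
          have he' : B.τG e.1 = s(p.1, p.2) := he
          exact ⟨hG1 e.1 e.2 _ (by rw [he']; simp), hG1 e.1 e.2 _ (by rw [he']; simp)⟩)
        (by
          rintro p ⟨-, e, he⟩
          have he' : B.τG e.1 = s(p.1, p.2) := he
          exact ⟨hV2 _ (hG2 e.1 e.2 _ (by rw [he']; simp)),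
            hV2 _ (hG2 e.1 e.2 _ (by rw [he']; simp))⟩) φ₁ φ₂
      obtain ⟨ψ, hψ2, hψ1, hs2, hs1⟩ := glue_aux W2 B.Qset _ _ q2 q1
        (by
          rintro p ⟨-, e, he⟩
          have he' : B.τH e.1 = s(p.1, p.2) := he
          exact ⟨hH2 e.1 e.2 _ (by rw [he']; simp), hH2 e.1 e.2 _ (by rw [he']; simp)⟩)
        (by
          rintro p ⟨-, e, he⟩
          have he' : B.τH e.1 = s(p.1, p.2) := he
          exact ⟨hW2 _ (hH1 e.1 e.2 _ (by rw [he']; simp)),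
            hW2 _ (hH1 e.1 e.2 _ (by rw [he']; simp))⟩) ψ₂ ψ₁
      refine ⟨(⟨DD B.Pset φ, φ, rfl⟩, ⟨DD B.Qset ψ, ψ, rfl⟩), ⟨?_, ?_, ?_⟩, ?_⟩
      · have h := (hℓ₁' φ₁).symm.trans hx
        show φ (B.eSndG ebar) - φ (B.eFstG ebar) = 1
        rw [hφ1 _ (hGb _ (B.eSndG_mem _)), hφ1 _ (hGb _ (B.eFstG_mem _))]
        exact h
      · have h := (hℓ₂' ψ₂).symm.trans hy
        show ψ (B.eSndH ebar) - ψ (B.eFstH ebar) = 1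
        rw [hψ2 _ (hHb _ (B.eSndH_mem _)), hψ2 _ (hHb _ (B.eFstH_mem _))]
        exact h
      · rintro ⟨e, hne⟩
        show (φ (B.eSndG e) - φ (B.eFstG e)) * (ψ (B.eSndH e) - ψ (B.eFstH e)) = lam ⟨e, hne⟩
        rcases hE e with h | h | h
        · exact absurd h hne
        · rw [hφ1 _ (hG1 e h _ (B.eSndG_mem _)), hφ1 _ (hG1 e h _ (B.eFstG_mem _)),
            hψ1 _ (hW2 _ (hH1 e h _ (B.eSndH_mem _))), hψ1 _ (hW2 _ (hH1 e h _ (B.eFstH_mem _)))]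
          exact hxy₁ ⟨e, h⟩
        · rw [hφ2 _ (hV2 _ (hG2 e h _ (B.eSndG_mem _))), hφ2 _ (hV2 _ (hG2 e h _ (B.eFstG_mem _))),
            hψ2 _ (hH2 e h _ (B.eSndH_mem _)), hψ2 _ (hH2 e h _ (B.eFstH_mem _))]
          exact (mul_comm _ _).trans (hxy₂ ⟨e, h⟩)
      · exact Prod.ext (Prod.ext hr1 hs1) (Prod.ext hs2 hr2)
  rw [← Set.finite_image_iff hinj, ← Nat.card_image_of_injOn hinj, himg]
  refine ⟨hf1.prod hf2, ?_⟩
  rw [← hc1, ← hc2, ← Nat.card_prod]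
  exact Nat.card_congr (Equiv.Set.prod _ _)

end LamanPaper
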